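/- The single-piece decomposition does not preserve termination of the restricted chase nor of the Datalog-first restricted chase. Concretely: the rule set 𝓡₁ = {P(x,y) → P(y,y) ∧ A(y); A(x) → ∃z.P(x,z)} belongs to CT_R^∀ but sp(𝓡₁) does not belong to CT_R^∀; and the rule set 𝓡₂ = {P(x,y,v) → ∃u,w.(P(y,y,u) ∧ A(y,w)); A(x,v) → ∃z,u.P(x,z,u)} belongs to CT_{df-R}^∀ but sp(𝓡₂) does not belong to CT_{df-R}^∀. -/

import Mathlib

namespace ExRules

open scoped Classical

noncomputable section

/-- Terms: constants or variables, each indexed by a natural number. -/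
inductive Term where
  | const : ℕ → Term
  | var : ℕ → Term
deriving DecidableEq

/-- An atom: a predicate symbol applied to a list of terms (the arity of the
predicate is the length of the argument list). -/
structure Atom where
  pred : ℕ
  args : List Term
deriving DecidableEq

/-- A factbase is a finite set of atoms. -/
abbrev FactBase := Finset Atom

/-- A substitution: a map on variables (extended by the identity on constants). -/
abbrev Subst := ℕ → Term

def applyTerm (σ : Subst) : Term → Term
  | .const c => .const c
  | .var v => σ v

def Atom.subst (σ : Subst) (a : Atom) : Atom := ⟨a.pred, a.args.map (applyTerm σ)⟩

def Term.vars : Term → Finset ℕ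
  | .const _ => ∅
  | .var v => {v}

def Atom.vars (a : Atom) : Finset ℕ := a.args.foldr (fun t s => t.vars ∪ s) ∅

def FactBase.vars (F : FactBase) : Finset ℕ := F.sup Atom.vars

/-- The variables occurring in a (possibly infinite) set of atoms. -/
def setVars (S : Set Atom) : Set ℕ := {v | ∃ a ∈ S, v ∈ a.vars}

/-- `σ` is a homomorphism from the atom set `S` to the atom set `S'`. -/
def IsHom (σ : Subst) (S S' : Set Atom) : Prop := ∀ a ∈ S, a.subst σ ∈ S'

/-- A retraction is a homomorphism that is the identity on the common variables. -/
def IsRetraction (σ : Subst) (S S' : Set Atom) : Prop :=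
  IsHom σ S S' ∧ ∀ v, v ∈ setVars S → v ∈ setVars S' → σ v = Term.var v

/-- An existential rule `B → ∃z.H` with nonempty body and head.  The frontier and
the existential variables are determined by the variables shared between body and
head. -/
structure Rule where
  body : Finset Atom
  head : Finset Atom
  body_nonempty : body.Nonempty
  head_nonempty : head.Nonempty

instance : DecidableEq Rule := fun R S =>
  decidable_of_iff (R.body = S.body ∧ R.head = S.head) (by
    constructor
    · rintro ⟨h1, h2⟩
      cases R; cases S; simp_all
    · rintro rfl; exact ⟨rfl, rfl⟩)

/-- The frontier of a rule: the variables shared by body and head. -/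
def Rule.frontier (R : Rule) : Finset ℕ := FactBase.vars R.body ∩ FactBase.vars R.head

/-- The existential variables of a rule: head variables not occurring in the body. -/
def Rule.exVars (R : Rule) : Finset ℕ := FactBase.vars R.head \ FactBase.vars R.body

/-- A rule is Datalog if it has no existential variable. -/
def Rule.IsDatalog (R : Rule) : Prop := R.exVars = ∅

/-- A rule has an atomic head if its head is a single atom. -/
def Rule.IsAtomicHead (R : Rule) : Prop := R.head.card = 1

/-- A rule set is a finite set of existential rules. -/
abbrev RuleSet := Finset Rule

instance : Encodable Term :=
  Encodable.ofEquiv (ℕ ⊕ ℕ)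
    { toFun := fun t => match t with | .const c => .inl c | .var v => .inr v
      invFun := fun s => match s with | .inl c => .const c | .inr v => .var v
      left_inv := by intro t; cases t <;> rfl
      right_inv := by intro s; cases s <;> rfl }

instance : Encodable Atom :=
  Encodable.ofEquiv (ℕ × List Term)
    { toFun := fun a => (a.pred, a.args)
      invFun := fun p => ⟨p.1, p.2⟩
      left_inv := fun _ => rfl
      right_inv := fun _ => rfl }

instance : Encodable Rule :=
  Encodable.ofEquiv {p : Finset Atom × Finset Atom // p.1.Nonempty ∧ p.2.Nonempty}
    { toFun := fun R => ⟨(R.body, R.head), R.body_nonempty, R.head_nonempty⟩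
      invFun := fun p => ⟨p.1.1, p.1.2, p.2.1, p.2.2⟩
      left_inv := fun _ => rfl
      right_inv := fun _ => rfl }

/-- A trigger `(R, π)`: a rule together with a substitution. -/
structure Trigger where
  rule : Rule
  map : Subst

/-- The canonical fresh variable `z_t` associated to a trigger `t` and an
existential variable `z`: it is unique for `z` and (the relevant part of) `t`. -/
def Trigger.freshVar (t : Trigger) (z : ℕ) : ℕ :=
  Nat.pair
    (Encodable.encode (t.rule, ((FactBase.vars t.rule.body).sort (· ≤ ·)).map t.map)) z

/-- The extension `π_R` of the substitution of a trigger, mapping each existential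
variable `z` to the fresh variable `z_t`. -/
def Trigger.ext (t : Trigger) : Subst := fun v =>
  if v ∈ t.rule.exVars then Term.var (t.freshVar v) else t.map v

/-- The output of a trigger: `out(t) = π_R(H)`. -/
def Trigger.out (t : Trigger) : Finset Atom := t.rule.head.image (Atom.subst t.ext)

/-- `t` is a trigger on the factbase `F`: its substitution is a homomorphism from
the body of its rule to `F`. -/
def Trigger.IsOn (t : Trigger) (F : FactBase) : Prop := IsHom t.map ↑t.rule.body ↑F

/-- The chase variants: oblivious, semi-oblivious, restricted, equivalent. -/
inductive Variant where
  | O | SO | R | E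

/-- Applicability of a trigger on a factbase, for each chase variant. -/
def Applicable : Variant → Trigger → FactBase → Prop
  | .O, t, F => ¬ t.out ⊆ F
  | .SO, t, F => ∀ t' : Trigger, t'.rule = t.rule →
      (∀ v ∈ t.rule.frontier, t'.map v = t.map v) → ¬ t'.out ⊆ F
  | .R, t, F => ¬ ∃ σ : Subst, IsRetraction σ ↑(F ∪ t.out) ↑F
  | .E, t, F => ¬ ∃ σ : Subst, IsHom σ ↑(F ∪ t.out) ↑F

/-- An atom set `M` satisfies a rule `B → ∃z.H` if every homomorphism from `B`
to `M` extends to a homomorphism mapping `H` into `M`. -/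
def SatisfiesRule (M : Set Atom) (R : Rule) : Prop :=
  ∀ σ : Subst, IsHom σ ↑R.body M →
    ∃ σ' : Subst, (∀ v ∈ FactBase.vars R.body, σ' v = σ v) ∧ IsHom σ' ↑R.head M

/-- A (finite or infinite) derivation from the knowledge base `⟨𝓡, F⟩`:
`len` is the number of triggers (possibly `⊤`), `fb i` is the `i`-th factbase and,
for `i < len`, `tr i` is the trigger producing `fb (i+1)` from `fb i`. -/
structure Derivation (𝓡 : RuleSet) (F : FactBase) where
  len : ℕ∞
  fb : ℕ → FactBase
  tr : ℕ → Trigger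
  fb_zero : fb 0 = F
  rule_mem : ∀ i : ℕ, (i : ℕ∞) < len → (tr i).rule ∈ 𝓡
  trig_on : ∀ i : ℕ, (i : ℕ∞) < len → (tr i).IsOn (fb i)
  trig_new : ∀ i : ℕ, (i : ℕ∞) < len → ¬ (tr i).out ⊆ fb i
  fb_succ : ∀ i : ℕ, (i : ℕ∞) < len → fb (i + 1) = fb i ∪ (tr i).out
  fb_stall : ∀ i : ℕ, ¬ (i : ℕ∞) < len → fb (i + 1) = fb i

namespace Derivation

variable {𝓡 : RuleSet} {F : FactBase}

/-- An `X`-derivation: every applied trigger is `X`-applicable when applied. -/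
def IsX (X : Variant) (D : Derivation 𝓡 F) : Prop :=
  ∀ i : ℕ, (i : ℕ∞) < D.len → Applicable X (D.tr i) (D.fb i)

/-- Datalog-first: a non-Datalog rule is only applied when all Datalog rules of
the rule set are satisfied. -/
def DatalogFirst (D : Derivation 𝓡 F) : Prop :=
  ∀ i : ℕ, (i : ℕ∞) < D.len → ¬ (D.tr i).rule.IsDatalog →
    ∀ R ∈ 𝓡, R.IsDatalog → SatisfiesRule ↑(D.fb i) R

/-- Fairness: every trigger `X`-applicable on some factbase of the derivation is
eventually not `X`-applicable. -/
def Fair (X : Variant) (D : Derivation 𝓡 F) : Prop :=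
  ∀ i : ℕ, (i : ℕ∞) ≤ D.len → ∀ t : Trigger, t.rule ∈ 𝓡 → t.IsOn (D.fb i) →
    Applicable X t (D.fb i) →
    ∃ j : ℕ, i < j ∧ (j : ℕ∞) ≤ D.len ∧ ¬ Applicable X t (D.fb j)

/-- A derivation is finite if its length is not `⊤`. -/
def Finite (D : Derivation 𝓡 F) : Prop := D.len ≠ ⊤

end Derivation

/-- `CT_X^∀` (non-Datalog-first): every fair `X`-derivation from every KB is finite. -/
def CTall (X : Variant) (𝓡 : RuleSet) : Prop :=
  ∀ F : FactBase, ∀ D : Derivation 𝓡 F, D.IsX X → D.Fair X → D.Finite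

/-- `CT_X^∃`: some fair `X`-derivation from every KB is finite. -/
def CTex (X : Variant) (𝓡 : RuleSet) : Prop :=
  ∀ F : FactBase, ∃ D : Derivation 𝓡 F, D.IsX X ∧ D.Fair X ∧ D.Finite

/-- `CT_{df-X}^∀`: every fair Datalog-first `X`-derivation from every KB is finite. -/
def CTallDF (X : Variant) (𝓡 : RuleSet) : Prop :=
  ∀ F : FactBase, ∀ D : Derivation 𝓡 F, D.IsX X → D.DatalogFirst → D.Fair X → D.Finite

/-- `CT_{df-X}^∃`: some fair Datalog-first `X`-derivation from every KB is finite. -/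
def CTexDF (X : Variant) (𝓡 : RuleSet) : Prop :=
  ∀ F : FactBase, ∃ D : Derivation 𝓡 F, D.IsX X ∧ D.DatalogFirst ∧ D.Fair X ∧ D.Finite

/-! ### Single-piece decomposition -/

/-- Adjacency in the piece graph of a rule: two head atoms sharing an existential
variable. -/
def PieceAdj (R : Rule) (a b : Atom) : Prop :=
  a ∈ R.head ∧ b ∈ R.head ∧ (a.vars ∩ b.vars ∩ R.exVars).Nonempty

/-- The piece (connected component of the piece graph) containing a given head atom. -/
def pieceOf (R : Rule) (a : Atom) : Finset Atom :=
  R.head.filter fun b => Relation.ReflTransGen (PieceAdj R) a b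

theorem self_mem_pieceOf {R : Rule} {a : Atom} (h : a ∈ R.head) : a ∈ pieceOf R a := by
  rw [pieceOf, Finset.mem_filter]
  exact ⟨h, Relation.ReflTransGen.refl⟩

/-- The single-piece decomposition of a rule. -/
def Rule.sp (R : Rule) : Finset Rule :=
  R.head.attach.image fun a =>
    ⟨R.body, pieceOf R a.1, R.body_nonempty, ⟨a.1, self_mem_pieceOf a.2⟩⟩

/-- The single-piece decomposition of a rule set. -/
def spSet (𝓡 : RuleSet) : RuleSet := 𝓡.biUnion Rule.sp

/-! ### Atomic decompositions -/

/-- The predicates occurring in a rule set. -/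
def RuleSet.predsF (𝓡 : RuleSet) : Finset ℕ :=
  𝓡.sup fun R => (R.body.image Atom.pred) ∪ (R.head.image Atom.pred)

/-- A fresh predicate `X_R`, unique for `R` and not occurring in `𝓡`. -/
def freshPred (𝓡 : RuleSet) (R : Rule) : ℕ :=
  (RuleSet.predsF 𝓡).sup id + 1 + Encodable.encode R

/-- The atom `X_R(x, z)` over the fresh predicate, whose arguments are the frontier
variables followed by the existential variables of `R`. -/
def xAtom (𝓡 : RuleSet) (R : Rule) : Atom :=
  ⟨freshPred 𝓡 R,
    ((R.frontier.sort (· ≤ ·)).map Term.var) ++ ((R.exVars.sort (· ≤ ·)).map Term.var)⟩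

/-- The one-way atomic decomposition of a rule `R = B → ∃z.H` (relative to `𝓡`):
the rule `B → ∃z.X_R(x,z)` together with a rule `X_R(x,z) → P(t)` for each head atom. -/
def oneAdRule (𝓡 : RuleSet) (R : Rule) : Finset Rule :=
  insert ⟨R.body, {xAtom 𝓡 R}, R.body_nonempty, Finset.singleton_nonempty _⟩
    (R.head.attach.image fun a =>
      ⟨{xAtom 𝓡 R}, {a.1}, Finset.singleton_nonempty _, Finset.singleton_nonempty _⟩)

/-- The one-way atomic decomposition of a rule set. -/
def oneAd (𝓡 : RuleSet) : RuleSet := 𝓡.biUnion (oneAdRule 𝓡)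

/-- The two-way atomic decomposition: `2ad(R) = 1ad(R) ∪ {H[x,z] → X_R(x,z)}`. -/
def twoAd (𝓡 : RuleSet) : RuleSet :=
  oneAd 𝓡 ∪ 𝓡.image fun R =>
    ⟨R.head, {xAtom 𝓡 R}, R.head_nonempty, Finset.singleton_nonempty _⟩

/-! ### Models, entailment, BDDP -/

/-- `M` is a model of the rule set `𝓡`. -/
def IsModelOfRules (𝓡 : RuleSet) (M : Set Atom) : Prop := ∀ R ∈ 𝓡, SatisfiesRule M R

/-- `M` is a model of the knowledge base `⟨𝓡, F⟩`. -/
def IsModelOfKB (𝓡 : RuleSet) (F : FactBase) (M : Set Atom) : Prop :=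
  IsModelOfRules 𝓡 M ∧ ∃ σ : Subst, IsHom σ ↑F M

/-- `M` is a universal model of `⟨𝓡, F⟩`: a model mapping homomorphically into
every model. -/
def IsUniversalModel (𝓡 : RuleSet) (F : FactBase) (M : Set Atom) : Prop :=
  IsModelOfKB 𝓡 F M ∧ ∀ N : Set Atom, IsModelOfKB 𝓡 F N → ∃ σ : Subst, IsHom σ M N

/-- An atom set entails a Boolean conjunctive query `Q` if `Q` maps
homomorphically into it. -/
def EntailsQ (S : Set Atom) (Q : Finset Atom) : Prop := ∃ σ : Subst, IsHom σ ↑Q S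

/-- `⟨𝓡, F⟩ ⊨ Q`: every model of the KB entails `Q`. -/
def KBEntails (𝓡 : RuleSet) (F : FactBase) (Q : Finset Atom) : Prop :=
  ∀ M : Set Atom, IsModelOfKB 𝓡 F M → EntailsQ M Q

/-- `R(F)`: the minimal atom set including `F` and `out(t)` for every trigger `t`
with rule `R` on `F`. -/
def ruleStep (R : Rule) (S : Set Atom) : Set Atom :=
  S ∪ {a | ∃ t : Trigger, t.rule = R ∧ IsHom t.map ↑R.body S ∧ a ∈ t.out}

/-- `𝓡(F) = ⋃_{R ∈ 𝓡} R(F)` (together with `F`). -/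
def setStep (𝓡 : RuleSet) (S : Set Atom) : Set Atom := S ∪ ⋃ R ∈ 𝓡, ruleStep R S

/-- The breadth-first chase `Ch_i(⟨𝓡, F⟩)`. -/
def ch (𝓡 : RuleSet) (F : FactBase) : ℕ → Set Atom
  | 0 => ↑F
  | i + 1 => setStep 𝓡 (ch 𝓡 F i)

/-- The bounded derivation depth property. -/
def BDDP (𝓡 : RuleSet) : Prop :=
  ∀ Q : Finset Atom, ∃ k : ℕ, ∀ F : FactBase, KBEntails 𝓡 F Q ↔ EntailsQ (ch 𝓡 F k) Q

/-! ### Conservative extensions -/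

/-- The restriction of an atom set to the atoms over a given set of predicates. -/
def restrictTo (M : Set Atom) (P : Set ℕ) : Set Atom := {a ∈ M | a.pred ∈ P}

/-- The terms (domain elements) of an atom set. -/
def termsOf (M : Set Atom) : Set Term := {u | ∃ a ∈ M, u ∈ a.args}

/-- `𝓡'` is a conservative extension of `𝓡`. -/
def ConservativeExt (𝓡 𝓡' : RuleSet) : Prop :=
  (↑(RuleSet.predsF 𝓡) : Set ℕ) ⊆ ↑(RuleSet.predsF 𝓡') ∧
  (∀ M : Set Atom, IsModelOfRules 𝓡' M →
    IsModelOfRules 𝓡 (restrictTo M ↑(RuleSet.predsF 𝓡))) ∧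
  (∀ M : Set Atom, IsModelOfRules 𝓡 M →
    ∃ M' : Set Atom, M ⊆ M' ∧ IsModelOfRules 𝓡' M' ∧ termsOf M' = termsOf M ∧
      restrictTo M' ↑(RuleSet.predsF 𝓡) = restrictTo M ↑(RuleSet.predsF 𝓡))

/-- `𝓡'` is a universal-conservative extension of `𝓡`. -/
def UnivConservativeExt (𝓡 𝓡' : RuleSet) : Prop :=
  (↑(RuleSet.predsF 𝓡) : Set ℕ) ⊆ ↑(RuleSet.predsF 𝓡') ∧
  ∀ F : FactBase, (∀ a ∈ F, a.pred ∈ RuleSet.predsF 𝓡) →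
    (∀ M : Set Atom, IsUniversalModel 𝓡' F M →
      IsUniversalModel 𝓡 F (restrictTo M ↑(RuleSet.predsF 𝓡))) ∧
    (∀ M : Set Atom, IsUniversalModel 𝓡 F M →
      ∃ M' : Set Atom, M ⊆ M' ∧ IsUniversalModel 𝓡' F M' ∧ termsOf M' = termsOf M ∧
        restrictTo M' ↑(RuleSet.predsF 𝓡) = restrictTo M ↑(RuleSet.predsF 𝓡))

def aP (t u : Term) : Atom := ⟨0, [t, u]⟩
def aA (t : Term) : Atom := ⟨1, [t]⟩
def aP3 (t u v : Term) : Atom := ⟨2, [t, u, v]⟩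
def aA2 (t u : Term) : Atom := ⟨3, [t, u]⟩
def vx : Term := Term.var 0
def vy : Term := Term.var 1
def vz : Term := Term.var 2
def vu : Term := Term.var 3
def vv : Term := Term.var 4
def vw : Term := Term.var 5

/-- `𝓡₁ = {P(x,y) → P(y,y) ∧ A(y); A(x) → ∃z.P(x,z)}`. -/
def R1set : RuleSet :=
  { ⟨{aP vx vy}, {aP vy vy, aA vy}, Finset.singleton_nonempty _, Finset.insert_nonempty _ _⟩,
    ⟨{aA vx}, {aP vx vz}, Finset.singleton_nonempty _, Finset.singleton_nonempty _⟩ }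

/-- `𝓡₂ = {P(x,y,v) → ∃u,w.(P(y,y,u) ∧ A(y,w)); A(x,v) → ∃z,u.P(x,z,u)}`. -/
def R2set : RuleSet :=
  { ⟨{aP3 vx vy vv}, {aP3 vy vy vu, aA2 vy vw},
      Finset.singleton_nonempty _, Finset.insert_nonempty _ _⟩,
    ⟨{aA2 vx vv}, {aP3 vx vz vu}, Finset.singleton_nonempty _, Finset.singleton_nonempty _⟩ }

theorem Atom.mem_vars {a : Atom} {v : ℕ} : v ∈ a.vars ↔ Term.var v ∈ a.args := by
  obtain ⟨p, l⟩ := a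
  induction l with
  | nil => simp [Atom.vars]
  | cons t l ih =>
    simp only [Atom.vars, List.foldr_cons, Finset.mem_union, List.mem_cons] at ih ⊢
    rw [ih]
    cases t <;> simp [Term.vars]

theorem FactBase.mem_vars {F : FactBase} {v : ℕ} : v ∈ F.vars ↔ ∃ a ∈ F, v ∈ a.vars :=
  Finset.mem_sup

theorem mem_setVars_coe {F : FactBase} {v : ℕ} : v ∈ setVars ↑F ↔ v ∈ F.vars := by
  simp [setVars, FactBase.mem_vars]

theorem FactBase.mem_vars_union {F G : FactBase} {v : ℕ} :
    v ∈ FactBase.vars (F ∪ G) ↔ v ∈ F.vars ∨ v ∈ G.vars := by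
  simp only [FactBase.mem_vars, Finset.mem_union, or_and_right, exists_or]

theorem Atom.subst_congr {a : Atom} {σ τ : Subst} (h : ∀ v ∈ a.vars, σ v = τ v) :
    a.subst σ = a.subst τ := by
  simp only [Atom.subst, Atom.mk.injEq, true_and, List.map_inj_left]
  rintro (c | v) ht
  · rfl
  · exact h v (Atom.mem_vars.2 ht)

theorem applyTerm_var (t : Term) : applyTerm Term.var t = t := by
  cases t <;> rfl

theorem Atom.subst_eq_self {a : Atom} {σ : Subst} (h : ∀ v ∈ a.vars, σ v = Term.var v) :
    a.subst σ = a := by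
  rw [Atom.subst_congr h]
  simp [Atom.subst, funext applyTerm_var]

theorem Atom.subst_subst (a : Atom) (σ τ : Subst) :
    (a.subst σ).subst τ = a.subst fun v => applyTerm τ (σ v) := by
  simp only [Atom.subst, List.map_map, Atom.mk.injEq, true_and, List.map_inj_left]
  rintro (c | v) - <;> rfl

theorem Atom.mem_vars_subst {a : Atom} {σ : Subst} {v : ℕ} :
    v ∈ (a.subst σ).vars ↔ ∃ u ∈ a.vars, σ u = Term.var v := by
  simp only [Atom.mem_vars, Atom.subst, List.mem_map]
  constructor
  · rintro ⟨c | u, ht, hu⟩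
    · simp [applyTerm] at hu
    · exact ⟨u, ht, hu⟩
  · rintro ⟨u, ht, hu⟩
    exact ⟨_, ht, hu⟩

theorem IsHom.mono {σ : Subst} {S T T' : Set Atom} (h : IsHom σ S T) (hT : T ⊆ T') :
    IsHom σ S T' :=
  fun a ha => hT (h a ha)

namespace Trigger

variable {t t' : Trigger} {F : FactBase}

/-- The map of `t` extends to a homomorphism from the head of its rule to `S`. -/
def Satisfied (t : Trigger) (S : Set Atom) : Prop :=
  ∃ σ : Subst, (∀ v ∈ FactBase.vars t.rule.body, σ v = t.map v) ∧ IsHom σ ↑t.rule.head S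

theorem freshVar_inj {z z' : ℕ} (h : t.freshVar z = t'.freshVar z') :
    t.rule = t'.rule ∧ (∀ v ∈ FactBase.vars t.rule.body, t.map v = t'.map v) ∧ z = z' := by
  obtain ⟨h1, h2⟩ := Nat.pair_eq_pair.1 h
  have h3 := Encodable.encode_injective h1
  rw [Prod.mk.injEq] at h3
  obtain ⟨h4, h5⟩ := h3
  rw [h4, List.map_inj_left] at h5
  refine ⟨h4, fun v hv => h5 v ?_, h2⟩
  rwa [Finset.mem_sort, ← h4]

theorem ext_of_mem_body {v : ℕ} (hv : v ∈ FactBase.vars t.rule.body) : t.ext v = t.map v := by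
  simp [ext, Rule.exVars, hv]

theorem ext_of_mem_exVars {v : ℕ} (hv : v ∈ t.rule.exVars) :
    t.ext v = Term.var (t.freshVar v) :=
  if_pos hv

theorem mem_body_or_mem_exVars {R : Rule} {a : Atom} (ha : a ∈ R.head) {v : ℕ}
    (hv : v ∈ a.vars) : v ∈ FactBase.vars R.body ∨ v ∈ R.exVars := by
  by_cases h : v ∈ FactBase.vars R.body
  · exact .inl h
  · exact .inr (Finset.mem_sdiff.2 ⟨FactBase.mem_vars.2 ⟨a, ha, hv⟩, h⟩)

theorem out_congr (hr : t.rule = t'.rule)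
    (hm : ∀ v ∈ FactBase.vars t.rule.body, t.map v = t'.map v) : t.out = t'.out := by
  obtain ⟨R, π⟩ := t
  obtain ⟨R', π'⟩ := t'
  obtain rfl : R = R' := hr
  refine Finset.image_congr fun a ha => Atom.subst_congr fun v hv => ?_
  rcases mem_body_or_mem_exVars ha hv with h | h
  · rw [ext_of_mem_body h, ext_of_mem_body (t := ⟨R, π'⟩) h, hm v h]
  · rw [ext_of_mem_exVars h, ext_of_mem_exVars (t := ⟨R, π'⟩) h, freshVar, freshVar]
    congr 4
    exact List.map_inj_left.2 fun u hu => hm u ((Finset.mem_sort _).1 hu)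

theorem mem_vars_of_isOn (h : t.IsOn F) {v u : ℕ} (hv : v ∈ FactBase.vars t.rule.body)
    (hu : t.map v = Term.var u) : u ∈ F.vars := by
  obtain ⟨a, ha, hva⟩ := FactBase.mem_vars.1 hv
  exact FactBase.mem_vars.2 ⟨_, h a ha, Atom.mem_vars_subst.2 ⟨v, hva, hu⟩⟩

theorem subst_ext_mem_out {a : Atom} (ha : a ∈ t.rule.head) : a.subst t.ext ∈ t.out :=
  Finset.mem_image_of_mem _ ha

theorem mem_vars_or_eq_freshVar (h : t.IsOn F) {v : ℕ} (hv : v ∈ FactBase.vars t.out) :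
    v ∈ F.vars ∨ ∃ z ∈ t.rule.exVars, v = t.freshVar z := by
  obtain ⟨b, hb, hvb⟩ := FactBase.mem_vars.1 hv
  obtain ⟨a, ha, rfl⟩ := Finset.mem_image.1 hb
  obtain ⟨u, hu, huv⟩ := Atom.mem_vars_subst.1 hvb
  rcases mem_body_or_mem_exVars ha hu with h' | h'
  · exact .inl (mem_vars_of_isOn h h' (ext_of_mem_body h' ▸ huv))
  · rw [ext_of_mem_exVars h', Term.var.injEq] at huv
    exact .inr ⟨u, h', huv.symm⟩

theorem satisfied_of_out_subset {S : Set Atom} (h : ↑t.out ⊆ S) : t.Satisfied S :=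
  ⟨t.ext, fun _ hv => ext_of_mem_body hv, fun _ ha => h (subst_ext_mem_out ha)⟩

theorem not_applicable_of_out_subset (h : t.out ⊆ F) : ¬ Applicable .R t F := by
  refine not_not.2 ⟨Term.var, fun a ha => ?_, fun _ _ _ => rfl⟩
  rw [Atom.subst_eq_self fun _ _ => rfl]
  rwa [Finset.union_eq_left.2 h] at ha

theorem not_applicable_of_satisfied (hon : t.IsOn F)
    (hfresh : ∀ z ∈ t.rule.exVars, t.freshVar z ∉ F.vars) (hs : t.Satisfied ↑F) :
    ¬ Applicable .R t F := by
  obtain ⟨σ, hσ, hσ'⟩ := hs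
  obtain ⟨ρ, hρ, hρ'⟩ : ∃ ρ : Subst, (∀ z ∈ t.rule.exVars, ρ (t.freshVar z) = σ z) ∧
      ∀ v ∈ F.vars, ρ v = Term.var v := by
    refine ⟨fun v => if h : ∃ z ∈ t.rule.exVars, t.freshVar z = v then σ h.choose
      else Term.var v, fun z hz => ?_, fun v hv => dif_neg ?_⟩
    · have h : ∃ z' ∈ t.rule.exVars, t.freshVar z' = t.freshVar z := ⟨z, hz, rfl⟩
      simp only [dif_pos h, (freshVar_inj h.choose_spec.2).2.2]
    · rintro ⟨z, hz, rfl⟩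
      exact hfresh z hz hv
  refine not_not.2 ⟨ρ, fun a ha => ?_, fun v _ hv => hρ' v (mem_setVars_coe.1 hv)⟩
  rcases Finset.mem_union.1 ha with ha | ha
  · rw [Atom.subst_eq_self fun v hv => hρ' v (FactBase.mem_vars.2 ⟨a, ha, hv⟩)]
    exact ha
  · obtain ⟨b, hb, rfl⟩ := Finset.mem_image.1 ha
    rw [Atom.subst_subst]
    convert hσ' b hb using 1
    refine Atom.subst_congr fun v hv => ?_
    rcases mem_body_or_mem_exVars hb hv with h | h
    · rw [ext_of_mem_body h, hσ v h]
      cases hu : t.map v with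
      | const c => rfl
      | var u => exact hρ' u (mem_vars_of_isOn hon h hu)
    · rw [ext_of_mem_exVars h]
      exact hρ v h

theorem applicable_of_not_satisfied (hon : t.IsOn F) (hs : ¬ t.Satisfied ↑F) :
    Applicable .R t F := by
  rintro ⟨ρ, hρ, hρ'⟩
  refine hs ⟨fun v => applyTerm ρ (t.ext v), fun v hv => ?_, fun a ha => ?_⟩
  · dsimp only
    rw [ext_of_mem_body hv]
    cases hu : t.map v with
    | const c => rfl
    | var u =>
      have := mem_vars_of_isOn hon hv hu
      exact hρ' u (mem_setVars_coe.2 (FactBase.mem_vars_union.2 (.inl this)))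
        (mem_setVars_coe.2 this)
  · rw [← Atom.subst_subst]
    exact hρ _ (Finset.mem_union_right _ (subst_ext_mem_out ha))

end Trigger

namespace Derivation

variable {𝓡 : RuleSet} {F : FactBase} (D : Derivation 𝓡 F)

theorem fb_mono : Monotone D.fb := by
  refine monotone_nat_of_le_succ fun i => ?_
  by_cases hi : (i : ℕ∞) < D.len
  · rw [D.fb_succ i hi]
    exact Finset.subset_union_left
  · rw [D.fb_stall i hi]

variable {D}

theorem out_subset_fb {i j : ℕ} (hi : (i : ℕ∞) < D.len) (hij : i < j) :
    (D.tr i).out ⊆ D.fb j := by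
  refine subset_trans ?_ (D.fb_mono hij)
  rw [D.fb_succ i hi]
  exact Finset.subset_union_right

/-- A variable invented by a trigger occurs in a derivation only if it was already present
initially or if the output of that trigger has been produced. -/
theorem freshVar_mem_vars_fb {t : Trigger} {z i : ℕ}
    (h : t.freshVar z ∈ FactBase.vars (D.fb i)) :
    t.freshVar z ∈ F.vars ∨ t.out ⊆ D.fb i := by
  induction i with
  | zero => exact .inl (D.fb_zero ▸ h)
  | succ i ih =>
    have hsub := D.fb_mono i.le_succ
    by_cases hi : (i : ℕ∞) < D.len
    · rw [D.fb_succ i hi, FactBase.mem_vars_union] at h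
      replace h : t.freshVar z ∈ FactBase.vars (D.fb i) ∨
          ∃ z' ∈ (D.tr i).rule.exVars, t.freshVar z = (D.tr i).freshVar z' :=
        h.elim .inl fun h => Trigger.mem_vars_or_eq_freshVar (D.trig_on i hi) h
      rcases h with h | ⟨z', -, h⟩
      · exact (ih h).imp_right fun h => h.trans hsub
      · obtain ⟨h1, h2, -⟩ := Trigger.freshVar_inj h
        rw [Trigger.out_congr h1 h2]
        exact .inr (out_subset_fb hi i.lt_succ_self)
    · rw [D.fb_stall i hi] at h ⊢
      exact ih h

theorem injOn_out : Set.InjOn (fun i => (D.tr i).out) {i | (i : ℕ∞) < D.len} := by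
  intro i hi j hj hij
  dsimp only at hij
  rcases lt_trichotomy i j with h | h | h
  · exact absurd (hij ▸ out_subset_fb hi h) (D.trig_new j hj)
  · exact h
  · exact absurd (hij ▸ out_subset_fb hj h) (D.trig_new i hi)

/-- Only finitely many steps of a derivation invent a variable that occurs initially. -/
theorem finite_setOf_freshVar_mem :
    {i : ℕ | (i : ℕ∞) < D.len ∧
      ∃ z ∈ (D.tr i).rule.exVars, (D.tr i).freshVar z ∈ F.vars}.Finite := by
  refine (F.vars.finite_toSet.biUnion (t := fun v => {i : ℕ | (i : ℕ∞) < D.len ∧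
    ∃ z, (D.tr i).freshVar z = v}) fun v _ => Set.Subsingleton.finite ?_).subset ?_
  · rintro i ⟨hi, z, hz⟩ j ⟨hj, z', hz'⟩
    obtain ⟨h1, h2, -⟩ := Trigger.freshVar_inj (hz.trans hz'.symm)
    exact injOn_out hi hj (Trigger.out_congr h1 h2)
  · rintro i ⟨hi, z, -, hz⟩
    exact Set.mem_biUnion hz ⟨hi, z, rfl⟩

theorem IsX.not_satisfied (hX : D.IsX .R) {i : ℕ} (hi : (i : ℕ∞) < D.len)
    (hfresh : ∀ z ∈ (D.tr i).rule.exVars, (D.tr i).freshVar z ∉ F.vars) :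
    ¬ (D.tr i).Satisfied ↑(D.fb i) := by
  refine fun hs => Trigger.not_applicable_of_satisfied (D.trig_on i hi) (fun z hz hz' => ?_) hs
    (hX i hi)
  exact (freshVar_mem_vars_fb hz').elim (hfresh z hz) (D.trig_new i hi)

/-- An infinite derivation from a factbase without variables is fair as soon as its limit
satisfies all rules. -/
theorem fair_of_satisfiesRule (hF : F.vars = ∅) (hlen : D.len = ⊤)
    (h : ∀ R ∈ 𝓡, SatisfiesRule (⋃ i, (D.fb i : Set Atom)) R) : D.Fair .R := by
  intro i _ t ht hon _
  obtain ⟨σ, hσ, hσ'⟩ := h t.rule ht t.map (hon.mono (Set.subset_iUnion (fun i =>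
    (D.fb i : Set Atom)) i))
  have hmono : Monotone fun i => (D.fb i : Set Atom) := fun i j hij =>
    Finset.coe_subset.2 (D.fb_mono hij)
  obtain ⟨k, hk⟩ : ∃ k, ↑(t.rule.head.image (Atom.subst σ)) ⊆ (D.fb k : Set Atom) := by
    refine hmono.directed_le.exists_mem_subset_of_finset_subset_biUnion fun a ha => ?_
    obtain ⟨b, hb, rfl⟩ := Finset.mem_image.1 ha
    exact hσ' b hb
  have hik : i < max (i + 1) k := lt_max_of_lt_left i.lt_succ_self
  refine ⟨max (i + 1) k, hik, hlen ▸ le_top, fun happ => ?_⟩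
  have hon' : t.IsOn (D.fb (max (i + 1) k)) := hon.mono (hmono hik.le)
  by_cases hout : t.out ⊆ D.fb (max (i + 1) k)
  · exact Trigger.not_applicable_of_out_subset hout happ
  · refine Trigger.not_applicable_of_satisfied hon' (fun z _ hz => ?_) ⟨σ, hσ, fun a ha => ?_⟩ happ
    · rcases freshVar_mem_vars_fb hz with h | h
      · simp [hF] at h
      · exact hout h
    · exact hmono (le_max_right _ _) (hk (Finset.mem_image_of_mem _ ha))

end Derivation

/-- The factbases obtained from `F` by adding the outputs of a sequence of triggers. -/
def triggerSeqFB (F : FactBase) (tr : ℕ → Trigger) : ℕ → FactBase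
  | 0 => F
  | i + 1 => triggerSeqFB F tr i ∪ (tr i).out

theorem mem_triggerSeqFB {F : FactBase} {tr : ℕ → Trigger} {i : ℕ} {a : Atom} :
    a ∈ triggerSeqFB F tr i ↔ a ∈ F ∨ ∃ j < i, a ∈ (tr j).out := by
  induction i with
  | zero => simp [triggerSeqFB]
  | succ i ih =>
    simp only [triggerSeqFB, Finset.mem_union, ih, Order.lt_add_one_iff, le_iff_lt_or_eq,
      or_and_right, exists_or, exists_eq_left, or_assoc]

/-- An infinite sequence of triggers, each unsatisfied when it is applied, yields an infinite
restricted derivation. -/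
theorem exists_derivation_of_triggerSeq {𝓡 : RuleSet} {F : FactBase} {tr : ℕ → Trigger}
    (hmem : ∀ i, (tr i).rule ∈ 𝓡) (hon : ∀ i, (tr i).IsOn (triggerSeqFB F tr i))
    (hsat : ∀ i, ¬ (tr i).Satisfied ↑(triggerSeqFB F tr i)) :
    ∃ D : Derivation 𝓡 F, D.len = ⊤ ∧ D.fb = triggerSeqFB F tr ∧ D.IsX .R :=
  ⟨{ len := ⊤
     fb := triggerSeqFB F tr
     tr := tr
     fb_zero := rfl
     rule_mem := fun i _ => hmem i
     trig_on := fun i _ => hon i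
     trig_new := fun i _ h => hsat i (Trigger.satisfied_of_out_subset h)
     fb_succ := fun _ _ => rfl
     fb_stall := fun i h => absurd (ENat.natCast_lt_top i) h },
    rfl, rfl, fun i _ => Trigger.applicable_of_not_satisfied (hon i) (hsat i)⟩

theorem mem_sp_iff {R R' : Rule}
    (h : ∀ a ∈ R.head, ∀ b ∈ R.head, a ≠ b → a.vars ∩ b.vars ∩ R.exVars = ∅) :
    R' ∈ R.sp ↔ R'.body = R.body ∧ ∃ a ∈ R.head, R'.head = {a} := by
  have hpiece : ∀ a ∈ R.head, pieceOf R a = {a} := by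
    intro a ha
    ext b
    rw [pieceOf, Finset.mem_filter, Finset.mem_singleton]
    refine ⟨fun hb => ?_, fun hb => ⟨hb ▸ ha, hb ▸ .refl⟩⟩
    replace hb := hb.2
    induction hb with
    | refl => rfl
    | tail _ hbc ih =>
      obtain ⟨hb, hc, hne⟩ := hbc
      rw [← ih]
      by_contra hcb
      exact hne.ne_empty (h _ hb _ hc (Ne.symm hcb))
  obtain ⟨B, H, hB, hH⟩ := R'
  simp only [Rule.sp, Finset.mem_image, Finset.mem_attach, true_and, Subtype.exists]
  constructor
  · rintro ⟨a, ha, h⟩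
    exact ⟨(congrArg Rule.body h).symm, a, ha, (congrArg Rule.head h).symm.trans (hpiece a ha)⟩
  · rintro ⟨h1, a, ha, h2⟩
    exact ⟨a, ha, (Rule.mk.injEq ..).mpr ⟨h1.symm, (hpiece a ha).trans h2.symm⟩⟩

/-- The atom `P(s,t)`, with the additional argument `v` if `b` is true. -/
def pAtom (b : Bool) (s t v : Term) : Atom := cond b (aP3 s t v) (aP s t)

/-- The atom `A(s)`, with the additional argument `v` if `b` is true. -/
def aAtom (b : Bool) (s v : Term) : Atom := cond b (aA2 s v) (aA s)

variable {b : Bool}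

theorem pAtom_subst (s t v : Term) (σ : Subst) :
    (pAtom b s t v).subst σ = pAtom b (applyTerm σ s) (applyTerm σ t) (applyTerm σ v) := by
  cases b <;> rfl

theorem aAtom_subst (s v : Term) (σ : Subst) :
    (aAtom b s v).subst σ = aAtom b (applyTerm σ s) (applyTerm σ v) := by
  cases b <;> rfl

theorem pAtom_inj {s t v s' t' v' : Term} (h : pAtom b s t v = pAtom b s' t' v') :
    s = s' ∧ t = t' := by
  cases b <;> simp_all [pAtom, aP, aP3]

theorem aAtom_inj {s v s' v' : Term} (h : aAtom b s v = aAtom b s' v') : s = s' := by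
  cases b <;> simp_all [aAtom, aA, aA2]

theorem pAtom_ne_aAtom {s t v s' v' : Term} : pAtom b s t v ≠ aAtom b s' v' := by
  cases b <;> simp [pAtom, aAtom, aP, aP3, aA, aA2]

/-- The rule `P(x,y,v) → ∃u,w.(P(y,y,u) ∧ A(y,w))`, with the last arguments dropped if `b` is
false. -/
def forkRule (b : Bool) : Rule :=
  ⟨{pAtom b vx vy vv}, {pAtom b vy vy vu, aAtom b vy vw},
    Finset.singleton_nonempty _, Finset.insert_nonempty _ _⟩

/-- The piece `P(x,y,v) → ∃u.P(y,y,u)` of `forkRule`. -/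
def loopRule (b : Bool) : Rule :=
  ⟨{pAtom b vx vy vv}, {pAtom b vy vy vu},
    Finset.singleton_nonempty _, Finset.singleton_nonempty _⟩

/-- The piece `P(x,y,v) → ∃w.A(y,w)` of `forkRule`. -/
def markRule (b : Bool) : Rule :=
  ⟨{pAtom b vx vy vv}, {aAtom b vy vw},
    Finset.singleton_nonempty _, Finset.singleton_nonempty _⟩

/-- The rule `A(x,v) → ∃z,u.P(x,z,u)`, with the last arguments dropped if `b` is false. -/
def succRule (b : Bool) : Rule :=
  ⟨{aAtom b vx vv}, {pAtom b vx vz vu},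
    Finset.singleton_nonempty _, Finset.singleton_nonempty _⟩

/-- The common form of the rule sets `R1set` and `R2set`. -/
def ladderRules (b : Bool) : RuleSet := {forkRule b, succRule b}

theorem R1set_eq : R1set = ladderRules false := rfl

theorem R2set_eq : R2set = ladderRules true := rfl

theorem mem_spSet_ladderRules {R : Rule} :
    R ∈ spSet (ladderRules b) ↔ R = loopRule b ∨ R = markRule b ∨ R = succRule b := by
  obtain ⟨B, H, hB, hH⟩ := R
  rw [spSet, Finset.mem_biUnion]
  simp only [ladderRules, Finset.mem_insert, Finset.mem_singleton, exists_eq_or_imp,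
    exists_eq_left]
  rw [mem_sp_iff (by cases b <;> decide), mem_sp_iff (by cases b <;> decide)]
  simp only [forkRule, succRule, loopRule, markRule, Rule.mk.injEq, Finset.mem_insert,
    Finset.mem_singleton, exists_eq_or_imp, exists_eq_left]
  tauto

theorem isHom_pBody {σ : Subst} {S : Set Atom} :
    IsHom σ ↑({pAtom b vx vy vv} : Finset Atom) S ↔ pAtom b (σ 0) (σ 1) (σ 4) ∈ S := by
  simp [IsHom, pAtom_subst, vx, vy, vv, applyTerm]

theorem isHom_aBody {σ : Subst} {S : Set Atom} :
    IsHom σ ↑({aAtom b vx vv} : Finset Atom) S ↔ aAtom b (σ 0) (σ 4) ∈ S := by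
  simp [IsHom, aAtom_subst, vx, vv, applyTerm]

theorem vars_pBody :
    FactBase.vars {pAtom b vx vy vv} = cond b {0, 1, 4} {0, 1} := by
  cases b <;> decide

theorem vars_aBody :
    FactBase.vars {aAtom b vx vv} = cond b {0, 4} {0} := by
  cases b <;> decide

/-- The combinatorics behind termination of the undecomposed rules: `P` and `A` evolve by fork
steps at `y i`, and by successor steps (`i ∈ I`) from `y i` to `e i`. A fork marks a point only
together with its loop, so, outside a finite set `J` of exceptional steps, only initially marked
points get a successor. -/
theorem not_infinite_ladder {α : Type*} {P : ℕ → α → α → Prop} {A : ℕ → α → Prop} {y e : ℕ → α}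
    {I J : Set ℕ} (hP : {t | ∃ s, P 0 s t}.Finite) (hA : {s | A 0 s}.Finite) (hJ : J.Finite)
    (hfork : ∀ i, i ∉ I → (∃ s, P i s (y i)) ∧
      (∀ s t, P (i + 1) s t ↔ P i s t ∨ s = y i ∧ t = y i) ∧
      (∀ s, A (i + 1) s ↔ A i s ∨ s = y i) ∧ (i ∉ J → ¬ (P i (y i) (y i) ∧ A i (y i))))
    (hsucc : ∀ i ∈ I, A i (y i) ∧ (∀ s t, P (i + 1) s t ↔ P i s t ∨ s = y i ∧ t = e i) ∧
      (∀ s, A (i + 1) s ↔ A i s) ∧ (i ∉ J → ∀ t, ¬ P i (y i) t)) : False := by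
  have hPmono : ∀ s t, Monotone fun i => P i s t := fun s t => monotone_nat_of_le_succ fun i => by
    by_cases hi : i ∈ I
    · exact fun h => ((hsucc i hi).2.1 s t).2 (.inl h)
    · exact fun h => ((hfork i hi).2.1 s t).2 (.inl h)
  have hAmono : ∀ s, Monotone fun i => A i s := fun s => monotone_nat_of_le_succ fun i => by
    by_cases hi : i ∈ I
    · exact fun h => ((hsucc i hi).2.2.1 s).2 h
    · exact fun h => ((hfork i hi).2.2.1 s).2 (.inl h)
  have hAP : ∀ i s, A i s → A 0 s ∨ P i s s := by
    intro i
    induction i with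
    | zero => exact fun s => .inl
    | succ i ih =>
      intro s hs
      by_cases hi : i ∈ I
      · exact (ih s (((hsucc i hi).2.2.1 s).1 hs)).imp_right (hPmono s s i.le_succ)
      · rcases ((hfork i hi).2.2.1 s).1 hs with h | h
        · exact (ih s h).imp_right (hPmono s s i.le_succ)
        · exact .inr (((hfork i hi).2.1 s s).2 (.inr ⟨h, h⟩))
  have hI : (I \ J).Finite := by
    refine Set.Finite.of_finite_image (f := y) (hA.subset ?_) fun i hi j hj hij => ?_
    · rintro _ ⟨i, ⟨hi, hiJ⟩, rfl⟩
      obtain ⟨h1, -, -, h2⟩ := hsucc i hi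
      exact (hAP i _ h1).resolve_right (h2 hiJ _)
    · have key : ∀ i j, i ∈ I \ J → j ∈ I \ J → y i = y j → ¬ i < j := by
        intro i j hi hj hij hlt
        refine (hsucc j hj.1).2.2.2 hj.2 (e i) (hPmono _ _ (Nat.succ_le_of_lt hlt) ?_)
        exact ((hsucc i hi.1).2.1 _ _).2 (.inr ⟨hij.symm, rfl⟩)
      exact le_antisymm (not_lt.1 (key j i hj hi hij.symm)) (not_lt.1 (key i j hi hj hij))
  have hI' : I.Finite := (hI.union hJ).subset fun i hi => by
    by_cases h : i ∈ J
    · exact .inr h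
    · exact .inl ⟨hi, h⟩
  have hPe : ∀ i s t, P i s t → t ∈ {t | ∃ s, P 0 s t} ∪ e '' I := by
    intro i
    induction i with
    | zero => exact fun s t h => .inl ⟨s, h⟩
    | succ i ih =>
      intro s t hst
      by_cases hi : i ∈ I
      · rcases ((hsucc i hi).2.1 s t).1 hst with h | ⟨-, rfl⟩
        · exact ih s t h
        · exact .inr ⟨i, hi, rfl⟩
      · rcases ((hfork i hi).2.1 s t).1 hst with h | ⟨-, rfl⟩
        · exact ih s t h
        · exact ih _ _ (hfork i hi).1.choose_spec
  have hF : (I ∪ J)ᶜ.Finite := by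
    refine Set.Finite.of_finite_image (f := y) ((hP.union (hI'.image e)).subset ?_)
      fun i hi j hj hij => ?_
    · rintro _ ⟨i, hi, rfl⟩
      obtain ⟨s, hs⟩ := (hfork i fun h => hi (.inl h)).1
      exact hPe i s _ hs
    · have key : ∀ i j, i ∉ I ∪ J → j ∉ I ∪ J → y i = y j → ¬ i < j := by
        intro i j hi hj hij hlt
        obtain ⟨-, h1, h2, -⟩ := hfork i fun h => hi (.inl h)
        refine (hfork j fun h => hj (.inl h)).2.2.2 (fun h => hj (.inr h)) ⟨?_, ?_⟩
        · exact hPmono _ _ (Nat.succ_le_of_lt hlt) ((h1 _ _).2 (.inr ⟨hij.symm, hij.symm⟩))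
        · exact hAmono _ (Nat.succ_le_of_lt hlt) ((h2 _).2 (.inr hij.symm))
      exact le_antisymm (not_lt.1 (key j i hj hi hij.symm)) (not_lt.1 (key i j hi hj hij))
  exact Set.infinite_univ (((hI'.union hJ).union hF).subset fun i _ => em (i ∈ I ∪ J))

theorem satisfied_forkRule {σ : Subst} {S : Set Atom} {v w : Term}
    (hv : pAtom b (σ 1) (σ 1) v ∈ S) (hw : aAtom b (σ 1) w ∈ S) :
    (⟨forkRule b, σ⟩ : Trigger).Satisfied S := by
  refine ⟨fun n => if n = 3 then v else if n = 5 then w else σ n, ?_, ?_⟩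
  · simp only [forkRule, vars_pBody]
    cases b <;> simp
  · simp [forkRule, IsHom, pAtom_subst, aAtom_subst, applyTerm, vy, vu, vw, hv, hw]

theorem satisfied_loopRule {σ : Subst} {S : Set Atom} :
    (⟨loopRule b, σ⟩ : Trigger).Satisfied S ↔ ∃ v, pAtom b (σ 1) (σ 1) v ∈ S := by
  constructor
  · rintro ⟨τ, h1, h2⟩
    simp only [loopRule, IsHom, Finset.coe_singleton, Set.mem_singleton_iff, forall_eq,
      pAtom_subst] at h2
    have h3 : τ 1 = σ 1 := h1 1 (by simp only [loopRule, vars_pBody]; cases b <;> simp)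
    rw [← h3]
    exact ⟨_, h2⟩
  · rintro ⟨v, hv⟩
    refine ⟨fun n => if n = 3 then v else σ n, ?_, ?_⟩
    · simp only [loopRule, vars_pBody]
      cases b <;> simp
    · simp [loopRule, IsHom, pAtom_subst, applyTerm, vy, vu, hv]

theorem satisfied_markRule {σ : Subst} {S : Set Atom} :
    (⟨markRule b, σ⟩ : Trigger).Satisfied S ↔ ∃ v, aAtom b (σ 1) v ∈ S := by
  constructor
  · rintro ⟨τ, h1, h2⟩
    simp only [markRule, IsHom, Finset.coe_singleton, Set.mem_singleton_iff, forall_eq,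
      aAtom_subst] at h2
    have h3 : τ 1 = σ 1 := h1 1 (by simp only [markRule, vars_pBody]; cases b <;> simp)
    rw [← h3]
    exact ⟨_, h2⟩
  · rintro ⟨v, hv⟩
    refine ⟨fun n => if n = 5 then v else σ n, ?_, ?_⟩
    · simp only [markRule, vars_pBody]
      cases b <;> simp
    · simp [markRule, IsHom, aAtom_subst, applyTerm, vy, vw, hv]

theorem satisfied_succRule {σ : Subst} {S : Set Atom} :
    (⟨succRule b, σ⟩ : Trigger).Satisfied S ↔ ∃ t v, pAtom b (σ 0) t v ∈ S := by
  constructor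
  · rintro ⟨τ, h1, h2⟩
    simp only [succRule, IsHom, Finset.coe_singleton, Set.mem_singleton_iff, forall_eq,
      pAtom_subst] at h2
    have h3 : τ 0 = σ 0 := h1 0 (by simp only [succRule, vars_aBody]; cases b <;> simp)
    rw [← h3]
    exact ⟨_, _, h2⟩
  · rintro ⟨t, v, hv⟩
    refine ⟨fun n => if n = 2 then t else if n = 3 then v else σ n, ?_, ?_⟩
    · simp only [succRule, vars_aBody]
      cases b <;> simp
    · simp [succRule, IsHom, pAtom_subst, applyTerm, vx, vz, vu, hv]

theorem out_forkRule (σ : Subst) : (⟨forkRule b, σ⟩ : Trigger).out =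
    {pAtom b (σ 1) (σ 1) ((⟨forkRule b, σ⟩ : Trigger).ext 3),
      aAtom b (σ 1) ((⟨forkRule b, σ⟩ : Trigger).ext 5)} := by
  have h : (⟨forkRule b, σ⟩ : Trigger).ext 1 = σ 1 :=
    Trigger.ext_of_mem_body (by simp only [forkRule, vars_pBody]; cases b <;> simp)
  rw [← h]
  exact (Finset.image_insert ..).trans (by
    rw [Finset.image_singleton, pAtom_subst, aAtom_subst]; rfl)

theorem out_loopRule (σ : Subst) : (⟨loopRule b, σ⟩ : Trigger).out =
    {pAtom b (σ 1) (σ 1) ((⟨loopRule b, σ⟩ : Trigger).ext 3)} := by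
  have h : (⟨loopRule b, σ⟩ : Trigger).ext 1 = σ 1 :=
    Trigger.ext_of_mem_body (by simp only [loopRule, vars_pBody]; cases b <;> simp)
  rw [← h]
  exact (Finset.image_singleton ..).trans (by rw [pAtom_subst]; rfl)

theorem out_markRule (σ : Subst) : (⟨markRule b, σ⟩ : Trigger).out =
    {aAtom b (σ 1) ((⟨markRule b, σ⟩ : Trigger).ext 5)} := by
  have h : (⟨markRule b, σ⟩ : Trigger).ext 1 = σ 1 :=
    Trigger.ext_of_mem_body (by simp only [markRule, vars_pBody]; cases b <;> simp)
  rw [← h]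
  exact (Finset.image_singleton ..).trans (by rw [aAtom_subst]; rfl)

theorem out_succRule (σ : Subst) : (⟨succRule b, σ⟩ : Trigger).out =
    {pAtom b (σ 0) ((⟨succRule b, σ⟩ : Trigger).ext 2)
      ((⟨succRule b, σ⟩ : Trigger).ext 3)} := by
  have h : (⟨succRule b, σ⟩ : Trigger).ext 0 = σ 0 :=
    Trigger.ext_of_mem_body (by simp only [succRule, vars_aBody]; cases b <;> simp)
  rw [← h]
  exact (Finset.image_singleton ..).trans (by rw [pAtom_subst]; rfl)

theorem ctall_ladderRules : CTall .R (ladderRules b) := by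
  intro F D hX _ hlen
  have hlt : ∀ i : ℕ, (i : ℕ∞) < D.len := fun i => hlen ▸ ENat.natCast_lt_top i
  refine not_infinite_ladder (P := fun i s t => ∃ v, pAtom b s t v ∈ D.fb i)
    (A := fun i s => ∃ v, aAtom b s v ∈ D.fb i)
    (y := fun i => if (D.tr i).rule = succRule b then (D.tr i).map 0 else (D.tr i).map 1)
    (e := fun i => (D.tr i).ext 2) (I := {i | (D.tr i).rule = succRule b}) ?_ ?_
    D.finite_setOf_freshVar_mem ?_ ?_
  · refine ((D.fb 0).finite_toSet.image fun a => a.args.getD 1 (.const 0)).subset ?_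
    rintro t ⟨s, v, h⟩
    exact ⟨_, h, by cases b <;> rfl⟩
  · refine ((D.fb 0).finite_toSet.image fun a => a.args.getD 0 (.const 0)).subset ?_
    rintro s ⟨v, h⟩
    exact ⟨_, h, by cases b <;> rfl⟩
  · intro i hi
    have hrule : (D.tr i).rule = forkRule b := by
      have := D.rule_mem i (hlt i)
      simp only [ladderRules, Finset.mem_insert, Finset.mem_singleton] at this
      exact this.resolve_right hi
    have hon := D.trig_on i (hlt i)
    have hnot := hX.not_satisfied (hlt i)
    rw [Set.mem_ofPred_eq] at hi
    simp only [if_neg hi, D.fb_succ i (hlt i), Set.mem_ofPred_eq, hlt i, true_and]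
    obtain ⟨σ, ht⟩ : ∃ σ, D.tr i = ⟨forkRule b, σ⟩ := ⟨(D.tr i).map, hrule ▸ rfl⟩
    rw [ht] at hon hnot ⊢
    simp only [out_forkRule, Finset.mem_union, Finset.mem_insert, Finset.mem_singleton]
    refine ⟨⟨_, _, isHom_pBody.1 hon⟩, fun s t => ⟨?_, ?_⟩, fun s => ⟨?_, ?_⟩, ?_⟩
    · rintro ⟨v, h | h | h⟩
      · exact .inl ⟨v, h⟩
      · exact .inr (pAtom_inj h)
      · exact absurd h pAtom_ne_aAtom
    · rintro (⟨v, h⟩ | ⟨rfl, rfl⟩)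
      · exact ⟨v, .inl h⟩
      · exact ⟨_, .inr (.inl rfl)⟩
    · rintro ⟨v, h | h | h⟩
      · exact .inl ⟨v, h⟩
      · exact absurd h.symm pAtom_ne_aAtom
      · exact .inr (aAtom_inj h)
    · rintro (⟨v, h⟩ | rfl)
      · exact ⟨v, .inl h⟩
      · exact ⟨_, .inr (.inr rfl)⟩
    · rintro hfresh ⟨⟨v, hv⟩, w, hw⟩
      exact hnot (fun z hz hz' => hfresh ⟨z, hz, hz'⟩) (satisfied_forkRule hv hw)
  · intro i hi
    have hon := D.trig_on i (hlt i)
    have hnot := hX.not_satisfied (hlt i)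
    rw [Set.mem_ofPred_eq] at hi
    simp only [if_pos hi, D.fb_succ i (hlt i), Set.mem_ofPred_eq, hlt i, true_and]
    obtain ⟨σ, ht⟩ : ∃ σ, D.tr i = ⟨succRule b, σ⟩ := ⟨(D.tr i).map, hi ▸ rfl⟩
    rw [ht] at hon hnot ⊢
    simp only [out_succRule, Finset.mem_union, Finset.mem_singleton]
    refine ⟨⟨_, isHom_aBody.1 hon⟩, fun s t => ⟨?_, ?_⟩, fun s => ⟨?_, ?_⟩, ?_⟩
    · rintro ⟨v, h | h⟩
      · exact .inl ⟨v, h⟩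
      · exact .inr (pAtom_inj h)
    · rintro (⟨v, h⟩ | ⟨rfl, rfl⟩)
      · exact ⟨v, .inl h⟩
      · exact ⟨_, .inr rfl⟩
    · rintro ⟨v, h | h⟩
      · exact ⟨v, h⟩
      · exact absurd h.symm pAtom_ne_aAtom
    · rintro ⟨v, h⟩
      exact ⟨v, .inl h⟩
    · rintro hfresh t ⟨v, hv⟩
      exact hnot (fun z hz hz' => hfresh ⟨z, hz, hz'⟩) (satisfied_succRule.2 ⟨t, v, hv⟩)

/-- The substitution reading off a triple of terms in a body atom `P(x,y,v)`. -/
def tripleSubst (s : Term × Term × Term) : Subst :=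
  fun n => if n = 0 then s.1 else if n = 1 then s.2.1 else s.2.2

/-- The trigger applying `markRule` to the atom `P(s)`. -/
def markTrigger (b : Bool) (s : Term × Term × Term) : Trigger := ⟨markRule b, tripleSubst s⟩

/-- The trigger applying `loopRule` to the atom `P(s)`. -/
def loopTrigger (b : Bool) (s : Term × Term × Term) : Trigger := ⟨loopRule b, tripleSubst s⟩

/-- The trigger applying `succRule` to the atom produced by `markTrigger`. -/
def succTrigger (b : Bool) (s : Term × Term × Term) : Trigger :=
  ⟨succRule b, fun n => if n = 0 then s.2.1 else (markTrigger b s).ext 5⟩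

/-- The successive `P`-atoms, as argument triples, of an infinite path built by alternating
`markTrigger` and `succTrigger`. -/
def ladder (b : Bool) : ℕ → Term × Term × Term
  | 0 => (.const 0, .const 1, .const 2)
  | k + 1 => ((ladder b k).2.1, (succTrigger b (ladder b k)).ext 2,
      (succTrigger b (ladder b k)).ext 3)

/-- The factbase containing the first atom of the ladder. -/
def ladderFB (b : Bool) : FactBase := {pAtom b (ladder b 0).1 (ladder b 0).2.1 (ladder b 0).2.2}

/-- The triggers building the ladder: each atom is marked, then extended, and only then its
loop is added. -/
def ladderTrigger (b : Bool) (i : ℕ) : Trigger :=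
  if i % 3 = 0 then markTrigger b (ladder b (i / 3))
  else if i % 3 = 1 then succTrigger b (ladder b (i / 3))
  else loopTrigger b (ladder b (i / 3))

theorem ladderTrigger_mark (k : ℕ) : ladderTrigger b (3 * k) = markTrigger b (ladder b k) := by
  simp [ladderTrigger]

theorem ladderTrigger_succ (k : ℕ) :
    ladderTrigger b (3 * k + 1) = succTrigger b (ladder b k) := by
  rw [ladderTrigger, if_neg (by omega), if_pos (by omega), show (3 * k + 1) / 3 = k by omega]

theorem ladderTrigger_loop (k : ℕ) :
    ladderTrigger b (3 * k + 2) = loopTrigger b (ladder b k) := by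
  rw [ladderTrigger, if_neg (by omega), if_neg (by omega), show (3 * k + 2) / 3 = k by omega]

theorem forall_nat_of_mod_three {p : ℕ → Prop} (h0 : ∀ k, p (3 * k)) (h1 : ∀ k, p (3 * k + 1))
    (h2 : ∀ k, p (3 * k + 2)) (i : ℕ) : p i := by
  have : i = 3 * (i / 3) ∨ i = 3 * (i / 3) + 1 ∨ i = 3 * (i / 3) + 2 := by omega
  rcases this with h | h | h <;> rw [h]
  exacts [h0 _, h1 _, h2 _]

theorem ladder_succ_snd (k : ℕ) : (ladder b (k + 1)).2.1 =
    Term.var ((succTrigger b (ladder b k)).freshVar 2) :=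
  Trigger.ext_of_mem_exVars (t := succTrigger b (ladder b k))
    (show 2 ∈ (succRule b).exVars by cases b <;> decide)

theorem ladder_snd_injective : Function.Injective fun k => (ladder b k).2.1 := by
  intro i
  induction i with
  | zero =>
    rintro (_ | j) h
    · rfl
    · simp only [ladder_succ_snd] at h
      simp [ladder] at h
  | succ i ih =>
    rintro (_ | j) h
    · simp only [ladder_succ_snd] at h
      simp [ladder] at h
    · simp only [ladder_succ_snd, Term.var.injEq] at h
      refine congrArg Nat.succ (ih ?_)
      exact (Trigger.freshVar_inj h).2.1 0 (by
        simp only [succTrigger, succRule, vars_aBody]; cases b <;> simp)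

theorem ladder_snd_ne_fst {k m : ℕ} (h : m ≤ k) : (ladder b k).2.1 ≠ (ladder b m).1 := by
  cases m with
  | zero =>
    cases k with
    | zero => simp [ladder]
    | succ k => rw [ladder_succ_snd]; simp [ladder]
  | succ m => exact fun hkm => absurd (ladder_snd_injective hkm) (by omega)

theorem out_markTrigger (s : Term × Term × Term) :
    (markTrigger b s).out = {aAtom b s.2.1 ((markTrigger b s).ext 5)} :=
  out_markRule _

theorem out_loopTrigger (s : Term × Term × Term) :
    (loopTrigger b s).out = {pAtom b s.2.1 s.2.1 ((loopTrigger b s).ext 3)} :=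
  out_loopRule _

theorem out_succTrigger (k : ℕ) : (succTrigger b (ladder b k)).out =
    {pAtom b (ladder b (k + 1)).1 (ladder b (k + 1)).2.1 (ladder b (k + 1)).2.2} :=
  out_succRule _

/-- The factbases of the ladder derivation. -/
abbrev ladderSeq (b : Bool) : ℕ → FactBase := triggerSeqFB (ladderFB b) (ladderTrigger b)

theorem mark_mem_ladderSeq {i k : ℕ} (h : 3 * k < i) :
    aAtom b (ladder b k).2.1 ((markTrigger b (ladder b k)).ext 5) ∈ ladderSeq b i :=
  mem_triggerSeqFB.2 (.inr ⟨3 * k, h, by simp [ladderTrigger_mark, out_markTrigger]⟩)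

theorem loop_mem_ladderSeq {i k : ℕ} (h : 3 * k + 2 < i) :
    pAtom b (ladder b k).2.1 (ladder b k).2.1 ((loopTrigger b (ladder b k)).ext 3) ∈
      ladderSeq b i :=
  mem_triggerSeqFB.2 (.inr ⟨3 * k + 2, h, by simp [ladderTrigger_loop, out_loopTrigger]⟩)

theorem ladder_mem_ladderSeq {i k : ℕ} (h : 3 * k < i + 2) :
    pAtom b (ladder b k).1 (ladder b k).2.1 (ladder b k).2.2 ∈ ladderSeq b i := by
  cases k with
  | zero => exact mem_triggerSeqFB.2 (.inl (Finset.mem_singleton_self _))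
  | succ k =>
    refine mem_triggerSeqFB.2 (.inr ⟨3 * k + 1, by omega, ?_⟩)
    simp [ladderTrigger_succ, out_succTrigger]

theorem exists_of_aAtom_mem_ladderSeq {i : ℕ} {s v : Term} (h : aAtom b s v ∈ ladderSeq b i) :
    ∃ k, 3 * k < i ∧ s = (ladder b k).2.1 := by
  rcases mem_triggerSeqFB.1 h with h | ⟨j, hj, h⟩
  · exact absurd (Finset.mem_singleton.1 h).symm pAtom_ne_aAtom
  · induction j using forall_nat_of_mod_three with
    | h0 k =>
      rw [ladderTrigger_mark, out_markTrigger, Finset.mem_singleton] at h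
      exact ⟨k, hj, aAtom_inj h⟩
    | h1 k =>
      rw [ladderTrigger_succ, out_succTrigger, Finset.mem_singleton] at h
      exact absurd h.symm pAtom_ne_aAtom
    | h2 k =>
      rw [ladderTrigger_loop, out_loopTrigger, Finset.mem_singleton] at h
      exact absurd h.symm pAtom_ne_aAtom

theorem exists_of_pAtom_mem_ladderSeq {i : ℕ} {s t v : Term}
    (h : pAtom b s t v ∈ ladderSeq b i) :
    ∃ k, t = (ladder b k).2.1 ∧
      (3 * k < i + 2 ∧ s = (ladder b k).1 ∨ 3 * k + 2 < i ∧ s = (ladder b k).2.1) := by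
  rcases mem_triggerSeqFB.1 h with h | ⟨j, hj, h⟩
  · obtain ⟨h1, h2⟩ := pAtom_inj (Finset.mem_singleton.1 h)
    exact ⟨0, h2, .inl ⟨by omega, h1⟩⟩
  · induction j using forall_nat_of_mod_three with
    | h0 k =>
      rw [ladderTrigger_mark, out_markTrigger, Finset.mem_singleton] at h
      exact absurd h pAtom_ne_aAtom
    | h1 k =>
      rw [ladderTrigger_succ, out_succTrigger, Finset.mem_singleton] at h
      obtain ⟨h1, h2⟩ := pAtom_inj h
      exact ⟨k + 1, h2, .inl ⟨by omega, h1⟩⟩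
    | h2 k =>
      rw [ladderTrigger_loop, out_loopTrigger, Finset.mem_singleton] at h
      obtain ⟨h1, h2⟩ := pAtom_inj h
      exact ⟨k, h2, .inr ⟨hj, h1⟩⟩

theorem ladderTrigger_rule_mem (i : ℕ) :
    (ladderTrigger b i).rule ∈ spSet (ladderRules b) := by
  rw [mem_spSet_ladderRules]
  induction i using forall_nat_of_mod_three with
  | h0 k => rw [ladderTrigger_mark]; exact .inr (.inl rfl)
  | h1 k => rw [ladderTrigger_succ]; exact .inr (.inr rfl)
  | h2 k => rw [ladderTrigger_loop]; exact .inl rfl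

theorem ladderTrigger_isOn (i : ℕ) : (ladderTrigger b i).IsOn (ladderSeq b i) := by
  induction i using forall_nat_of_mod_three with
  | h0 k =>
    rw [ladderTrigger_mark]
    exact isHom_pBody.2 (ladder_mem_ladderSeq (by omega))
  | h1 k =>
    rw [ladderTrigger_succ]
    exact isHom_aBody.2 (mark_mem_ladderSeq (by omega))
  | h2 k =>
    rw [ladderTrigger_loop]
    exact isHom_pBody.2 (ladder_mem_ladderSeq (by omega))

theorem ladderTrigger_not_satisfied (i : ℕ) :
    ¬ (ladderTrigger b i).Satisfied ↑(ladderSeq b i) := by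
  induction i using forall_nat_of_mod_three with
  | h0 k =>
    rw [ladderTrigger_mark, markTrigger, satisfied_markRule]
    rintro ⟨v, hv⟩
    obtain ⟨m, hm, h⟩ := exists_of_aAtom_mem_ladderSeq hv
    exact absurd (ladder_snd_injective h) (by omega)
  | h1 k =>
    rw [ladderTrigger_succ, succTrigger, satisfied_succRule]
    rintro ⟨t, v, hv⟩
    obtain ⟨m, -, ⟨hm, h⟩ | ⟨hm, h⟩⟩ := exists_of_pAtom_mem_ladderSeq hv
    · exact ladder_snd_ne_fst (by omega) h
    · exact absurd (ladder_snd_injective h) (by omega)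
  | h2 k =>
    rw [ladderTrigger_loop, loopTrigger, satisfied_loopRule]
    rintro ⟨v, hv⟩
    obtain ⟨m, h', ⟨hm, h⟩ | ⟨hm, h⟩⟩ := exists_of_pAtom_mem_ladderSeq hv
    · obtain rfl : k = m := ladder_snd_injective h'
      exact ladder_snd_ne_fst le_rfl h
    · exact absurd (ladder_snd_injective h) (by omega)

theorem iUnion_ladderSeq_satisfiesRule {R : Rule} (hR : R ∈ spSet (ladderRules b)) :
    SatisfiesRule (⋃ i, (ladderSeq b i : Set Atom)) R := by
  intro σ hσ
  rcases mem_spSet_ladderRules.1 hR with rfl | rfl | rfl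
  · obtain ⟨i, hi⟩ := Set.mem_iUnion.1 (isHom_pBody.1 hσ)
    obtain ⟨k, hk, -⟩ := exists_of_pAtom_mem_ladderSeq hi
    have hmem := loop_mem_ladderSeq (b := b) (k := k) (Nat.lt_succ_self _)
    rw [← hk] at hmem
    exact satisfied_loopRule.2 ⟨_, Set.mem_iUnion.2 ⟨_, hmem⟩⟩
  · obtain ⟨i, hi⟩ := Set.mem_iUnion.1 (isHom_pBody.1 hσ)
    obtain ⟨k, hk, -⟩ := exists_of_pAtom_mem_ladderSeq hi
    have hmem := mark_mem_ladderSeq (b := b) (k := k) (Nat.lt_succ_self _)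
    rw [← hk] at hmem
    exact satisfied_markRule.2 ⟨_, Set.mem_iUnion.2 ⟨_, hmem⟩⟩
  · obtain ⟨i, hi⟩ := Set.mem_iUnion.1 (isHom_aBody.1 hσ)
    obtain ⟨k, -, hk⟩ := exists_of_aAtom_mem_ladderSeq hi
    have hmem : pAtom b (ladder b k).2.1 _ _ ∈ _ :=
      ladder_mem_ladderSeq (b := b) (i := 3 * k + 2) (k := k + 1) (by omega)
    rw [← hk] at hmem
    exact satisfied_succRule.2 ⟨_, _, Set.mem_iUnion.2 ⟨_, hmem⟩⟩

theorem exists_infinite_fair_derivation (b : Bool) :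
    ∃ D : Derivation (spSet (ladderRules b)) (ladderFB b),
      D.IsX .R ∧ D.Fair .R ∧ D.len = ⊤ := by
  obtain ⟨D, hlen, hfb, hX⟩ := exists_derivation_of_triggerSeq (ladderTrigger_rule_mem (b := b))
    ladderTrigger_isOn ladderTrigger_not_satisfied
  refine ⟨D, hX, Derivation.fair_of_satisfiesRule (by cases b <;> decide) hlen ?_, hlen⟩
  rw [hfb]
  exact fun R => iUnion_ladderSeq_satisfiesRule

theorem not_isDatalog_of_mem_spSet {R : Rule} (hR : R ∈ spSet (ladderRules true)) :
    ¬ R.IsDatalog := by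
  rcases mem_spSet_ladderRules.1 hR with rfl | rfl | rfl <;>
    exact Finset.Nonempty.ne_empty (by decide)

/-- The single-piece decomposition preserves neither termination of
the restricted chase nor of the Datalog-first restricted chase, as witnessed by
`𝓡₁` and `𝓡₂` respectively. -/
theorem statement4 :
    (CTall Variant.R R1set ∧ ¬ CTall Variant.R (spSet R1set)) ∧
    (CTallDF Variant.R R2set ∧ ¬ CTallDF Variant.R (spSet R2set)) := by
  rw [R1set_eq, R2set_eq]
  refine ⟨⟨ctall_ladderRules, fun h => ?_⟩,
    fun F D hX _ hfair => ctall_ladderRules F D hX hfair, fun h => ?_⟩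
  · obtain ⟨D, hX, hfair, hlen⟩ := exists_infinite_fair_derivation false
    exact h _ D hX hfair hlen
  · obtain ⟨D, hX, hfair, hlen⟩ := exists_infinite_fair_derivation true
    refine h _ D hX (fun i hi _ R hR hdl => ?_) hfair hlen
    exact absurd hdl (not_isDatalog_of_mem_spSet hR)

end
end ExRules
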